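/- Let k ≥ 1, fix a bijection φ : {1,…,8k^3} → {1,…,k}^3 × {1,…,8}, and let J be any nonempty instruction sequence. Consider execution of CHECK; J starting at position 1 in a state where in:m holds b_m ∈ {t, f} for 1 ≤ m ≤ 8k^3 and aux:i holds a_i ∈ {t, f} for 1 ≤ i ≤ k. If the assignment a satisfies every clause γ_{φ(m)} with b_m = t, then execution terminates with reply t, with all registers unchanged at termination. Otherwise, execution reaches position 72k^3 (the first instruction of J) with all registers unchanged. -/

import Mathlib

/-- A focus (register name): an input register `in:i` or an auxiliary register `aux:i`. -/
inductive Focus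
  | inp (i : ℕ)
  | aux (i : ℕ)
  deriving DecidableEq

/-- A method of a Boolean register service. -/
inductive Method
  | setT
  | setF
  | get
  deriving DecidableEq

/-- A PGLB_bt primitive instruction. -/
inductive Instr
  | basic (f : Focus) (m : Method)   -- f.m
  | pos (f : Focus) (m : Method)     -- +f.m
  | neg (f : Focus) (m : Method)     -- -f.m
  | fjmp (l : ℕ)                     -- #l
  | bjmp (l : ℕ)                     -- \#l
  | termT                            -- !t
  | termF                            -- !f
  deriving DecidableEq

/-- A state assigns to every register a value in {t, f, d}; `none` represents `d`. -/
abbrev St := Focus → Option Bool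

/-- The reply produced when processing method `m` on a register holding `x`. -/
def procReply (m : Method) (x : Option Bool) : Option Bool :=
  match x, m with
  | none, _ => none
  | some b, .get => some b
  | some _, .setT => some true
  | some _, .setF => some true

/-- The new register value after processing method `m` on a register holding `x`. -/
def procEff (m : Method) (x : Option Bool) : Option Bool :=
  match x, m with
  | none, _ => none
  | some b, .get => some b
  | some _, .setT => some true
  | some _, .setF => some false

/-- Update a state by processing method `m` on the register named `f`. -/
def updSt (s : St) (f : Focus) (m : Method) : St :=
  fun g => if g = f then procEff m (s f) else s g

/-- An execution configuration: running at a (1-based) position in a state,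
terminated with a reply (recording the final state), or deadlocked. -/
inductive Config
  | running (i : ℕ) (s : St)
  | terminated (r : Bool) (s : St)
  | deadlock

/-- One execution step of the instruction sequence `I`. -/
def step (I : List Instr) : Config → Config
  | .terminated r s => .terminated r s
  | .deadlock => .deadlock
  | .running i s =>
    if i = 0 then .deadlock
    else
      match I[i - 1]? with
      | none => .deadlock
      | some u =>
        match u with
        | .basic f m =>
          match procReply m (s f) with
          | none => .deadlock
          | some _ => .running (i + 1) (updSt s f m)
        | .pos f m =>
          match procReply m (s f) with
          | none => .deadlock
          | some true => .running (i + 1) (updSt s f m)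
          | some false => .running (i + 2) (updSt s f m)
        | .neg f m =>
          match procReply m (s f) with
          | none => .deadlock
          | some true => .running (i + 2) (updSt s f m)
          | some false => .running (i + 1) (updSt s f m)
        | .fjmp l => .running (i + l) s
        | .bjmp l => if l < i then .running (i - l) s else .deadlock
        | .termT => .terminated true s
        | .termF => .terminated false s

/-- The configuration after `n` execution steps of `I`, starting at position 1 in state `s`. -/
def run (I : List Instr) (s : St) (n : ℕ) : Config :=
  (step I)^[n] (.running 1 s)

/-- Execution of `I` from state `s` terminates with reply `r`. -/
def TermWith (I : List Instr) (s : St) (r : Bool) : Prop :=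
  ∃ n s', run I s n = .terminated r s'

/-- An instruction sequence is loop-free if it contains no backward jump. -/
def LoopFree (I : List Instr) : Prop := ∀ l, Instr.bjmp l ∉ I

/-- An instruction refers to an auxiliary register. -/
def UsesAux : Instr → Prop
  | .basic (.aux _) _ => True
  | .pos (.aux _) _ => True
  | .neg (.aux _) _ => True
  | _ => False

/-- The initial state for computing a `k`-ary function using `l` auxiliary registers:
`in:i` holds `b_i` for `1 ≤ i ≤ k`, `aux:j` holds `t` for `1 ≤ j ≤ l`,
all other registers hold `d`. -/
def initSt (k l : ℕ) (b : Fin k → Bool) : St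
  | .inp i => if h : 1 ≤ i ∧ i ≤ k then some (b ⟨i - 1, by omega⟩) else none
  | .aux j => if 1 ≤ j ∧ j ≤ l then some true else none

/-- `I` computes the partial function `F : Bool^k ⇀ Bool` using `l` auxiliary registers. -/
def Computes (I : List Instr) (k l : ℕ) (F : (Fin k → Bool) → Option Bool) : Prop :=
  ∀ b : Fin k → Bool,
    (∀ r : Bool, F b = some r → TermWith I (initSt k l b) r) ∧
    (F b = none → ∀ r : Bool, ¬ TermWith I (initSt k l b) r)

/-- `posTest true f = +f.get` and `posTest false f = -f.get`. -/
def polTest (pb : Bool) (f : Focus) : Instr :=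
  if pb then .pos f .get else .neg f .get

/-- Sign of the first literal of the clause `γ_(l,m,n,i)`: positive iff `i ∈ {1,2,3,4}`. -/
def sgn1 (i : ℕ) : Bool := decide (i ≤ 4)

/-- Sign of the second literal of `γ_(l,m,n,i)`: positive iff `i ∈ {1,2,5,6}`. -/
def sgn2 (i : ℕ) : Bool := decide (i = 1 ∨ i = 2 ∨ i = 5 ∨ i = 6)

/-- Sign of the third literal of `γ_(l,m,n,i)`: positive iff `i` is odd. -/
def sgn3 (i : ℕ) : Bool := decide (i % 2 = 1)

/-- The assignment `a` satisfies the 3-clause `γ_(l,m,n,i)`,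
i.e. makes at least one of its three literals true. -/
def SatClause (a : ℕ → Bool) : ℕ × ℕ × ℕ × ℕ → Prop
  | (l, m, n, i) => a l = sgn1 i ∨ a m = sgn2 i ∨ a n = sgn3 i

/-- `CHECK_(l,m,n,i) = T₁ aux:l.get; #2; T₂ aux:m.get; #2; T₃ aux:n.get`. -/
def CHECKc : ℕ × ℕ × ℕ × ℕ → List Instr
  | (l, m, n, i) =>
    [polTest (sgn1 i) (.aux l), .fjmp 2, polTest (sgn2 i) (.aux m), .fjmp 2,
     polTest (sgn3 i) (.aux n)]

/-- The `m`-th guarded check (for a total of `K` clauses):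
`-in:m.get; #8; CHECK_{φ(m)}; #2; #9` if `m < K`, and
`-in:K.get; #6; CHECK_{φ(K)}; !t` if `m = K`. -/
def guarded (K : ℕ) (φ : ℕ → ℕ × ℕ × ℕ × ℕ) (m : ℕ) : List Instr :=
  if m < K then
    [.neg (.inp m) .get, .fjmp 8] ++ CHECKc (φ m) ++ [.fjmp 2, .fjmp 9]
  else
    [.neg (.inp m) .get, .fjmp 6] ++ CHECKc (φ m) ++ [.termT]

/-- `CHECK`: the concatenation of the guarded checks for `m = 1, …, 8k³`. -/
def CHECKseq (k : ℕ) (φ : ℕ → ℕ × ℕ × ℕ × ℕ) : List Instr :=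
  (List.range (8 * k ^ 3)).flatMap fun j => guarded (8 * k ^ 3) φ (j + 1)

/-- Executing `I` from the configuration `c₁` leads to `c₂`. -/
def Reaches (I : List Instr) (c₁ c₂ : Config) : Prop :=
  ∃ n, (step I)^[n] c₁ = c₂

theorem Reaches.refl (I : List Instr) (c : Config) : Reaches I c c := ⟨0, rfl⟩

theorem Reaches.trans {I : List Instr} {c₁ c₂ c₃ : Config}
    (h : Reaches I c₁ c₂) (h' : Reaches I c₂ c₃) : Reaches I c₁ c₃ := by
  obtain ⟨n, rfl⟩ := h
  obtain ⟨n', rfl⟩ := h'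
  exact ⟨n' + n, Function.iterate_add_apply ..⟩

theorem updSt_get (s : St) (f : Focus) : updSt s f .get = s := by
  funext g
  unfold updSt
  split
  · subst g
    cases s f <;> rfl
  · rfl

theorem reaches_jump {I : List Instr} {i l : ℕ} (s : St) (h : I[i]? = some (.fjmp l)) :
    Reaches I (.running (i + 1) s) (.running (i + 1 + l) s) :=
  ⟨1, by simp [step, h]⟩

theorem reaches_termT {I : List Instr} {i : ℕ} (s : St) (h : I[i]? = some .termT) :
    Reaches I (.running (i + 1) s) (.terminated true s) :=
  ⟨1, by simp [step, h]⟩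

theorem reaches_polTest {I : List Instr} {i : ℕ} {s : St} {p v : Bool} {f : Focus}
    (h : I[i]? = some (polTest p f)) (hs : s f = some v) :
    Reaches I (.running (i + 1) s) (.running (if v = p then i + 2 else i + 3) s) :=
  ⟨1, by cases p <;> cases v <;> simp_all [step, polTest, procReply, updSt_get]⟩

theorem reaches_polTest_eq {I : List Instr} {i : ℕ} {s : St} {p v : Bool} {f : Focus}
    (h : I[i]? = some (polTest p f)) (hs : s f = some v) (hv : v = p) :
    Reaches I (.running (i + 1) s) (.running (i + 2) s) := by
  simpa only [if_pos hv] using reaches_polTest h hs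

theorem reaches_polTest_ne {I : List Instr} {i : ℕ} {s : St} {p v : Bool} {f : Focus}
    (h : I[i]? = some (polTest p f)) (hs : s f = some v) (hv : v ≠ p) :
    Reaches I (.running (i + 1) s) (.running (i + 3) s) := by
  simpa only [if_neg hv] using reaches_polTest h hs

/-- A clause check leaves at its first exit if the clause is satisfied,
and one position later otherwise. -/
theorem reaches_CHECKc {I : List Instr} {q l m n i : ℕ} {s : St} {a : ℕ → Bool}
    (hI : ∀ r < 5, I[q + r]? = (CHECKc (l, m, n, i))[r]?)
    (hl : s (.aux l) = some (a l)) (hm : s (.aux m) = some (a m))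
    (hn : s (.aux n) = some (a n)) :
    (SatClause a (l, m, n, i) → Reaches I (.running (q + 1) s) (.running (q + 6) s)) ∧
    (¬ SatClause a (l, m, n, i) → Reaches I (.running (q + 1) s) (.running (q + 7) s)) := by
  have h0 : I[q]? = _ := hI 0 (by norm_num)
  have h2 := hI 2 (by norm_num)
  have h4 := hI 4 (by norm_num)
  have exit₂ : Reaches I (.running (q + 4) s) (.running (q + 6) s) :=
    reaches_jump s (hI 3 (by norm_num))
  have exit₁ : Reaches I (.running (q + 2) s) (.running (q + 6) s) :=
    (reaches_jump s (hI 1 (by norm_num))).trans exit₂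
  unfold SatClause
  by_cases c₁ : a l = sgn1 i
  · exact ⟨fun _ => (reaches_polTest_eq h0 hl c₁).trans exit₁, fun h => (h (.inl c₁)).elim⟩
  have pass₁ := reaches_polTest_ne h0 hl c₁
  by_cases c₂ : a m = sgn2 i
  · exact ⟨fun _ => pass₁.trans ((reaches_polTest_eq h2 hm c₂).trans exit₂),
      fun h => (h (.inr (.inl c₂))).elim⟩
  have pass₂ := pass₁.trans (reaches_polTest_ne h2 hm c₂)
  by_cases c₃ : a n = sgn3 i
  · exact ⟨fun _ => pass₂.trans (reaches_polTest_eq h4 hn c₃),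
      fun h => (h (.inr (.inr c₃))).elim⟩
  · exact ⟨fun h => by tauto, fun _ => pass₂.trans (reaches_polTest_ne h4 hn c₃)⟩

theorem length_guarded_of_lt {K m : ℕ} (φ : ℕ → ℕ × ℕ × ℕ × ℕ) (h : m < K) :
    (guarded K φ m).length = 9 := by
  simp [guarded, h, CHECKc]

theorem length_flatMap_guarded {K j : ℕ} (φ : ℕ → ℕ × ℕ × ℕ × ℕ) (h : j < K) :
    ((List.range j).flatMap fun i => guarded K φ (i + 1)).length = 9 * j := by
  induction j with
  | zero => rfl
  | succ j ih =>
    rw [List.range_succ, List.flatMap_append, List.length_append, ih (by omega)]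
    simp [length_guarded_of_lt φ h, mul_add]

theorem getElem?_flatMap_guarded {K j r : ℕ} (φ : ℕ → ℕ × ℕ × ℕ × ℕ) (J : List Instr)
    (h : j < K) (hr : r < (guarded K φ (j + 1)).length) :
    (((List.range K).flatMap fun i => guarded K φ (i + 1)) ++ J)[9 * j + r]? =
      (guarded K φ (j + 1))[r]? := by
  obtain ⟨d, rfl⟩ := Nat.exists_eq_add_of_lt h
  rw [add_assoc, List.range_add, List.flatMap_append, List.append_assoc,
    List.getElem?_append_right (by rw [length_flatMap_guarded φ (by omega)]; omega),
    length_flatMap_guarded φ (by omega), Nat.add_sub_cancel_left,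
    List.range_succ_eq_map, List.map_cons, List.flatMap_cons, List.append_assoc,
    add_zero, List.getElem?_append_left (by simpa [add_assoc] using hr)]

/-- Behaviour of a guarded check that is not the last one. -/
theorem reaches_guarded_of_lt {I : List Instr} {K q m : ℕ} {φ : ℕ → ℕ × ℕ × ℕ × ℕ} {s : St}
    {a : ℕ → Bool} {v : Bool} (hm : m < K)
    (hI : ∀ r < (guarded K φ m).length, I[q + r]? = (guarded K φ m)[r]?)
    (hv : s (.inp m) = some v)
    (h₁ : s (.aux (φ m).1) = some (a (φ m).1))
    (h₂ : s (.aux (φ m).2.1) = some (a (φ m).2.1))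
    (h₃ : s (.aux (φ m).2.2.1) = some (a (φ m).2.2.1)) :
    ((v = true → SatClause a (φ m)) → Reaches I (.running (q + 1) s) (.running (q + 10) s)) ∧
    (¬ (v = true → SatClause a (φ m)) → Reaches I (.running (q + 1) s) (.running (q + 9) s)) ∧
    Reaches I (.running (q + 9) s) (.running (q + 18) s) := by
  simp only [guarded, if_pos hm] at hI
  have hlen : ([.neg (.inp m) .get, .fjmp 8] ++ CHECKc (φ m) ++
    [.fjmp 2, .fjmp 9] : List Instr).length = 9 := by simp [CHECKc]
  rw [hlen] at hI
  have h0 : I[q]? = some (polTest false (.inp m)) := hI 0 (by norm_num)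
  have unselected : Reaches I (.running (q + 2) s) (.running (q + 10) s) :=
    reaches_jump s (hI 1 (by norm_num))
  have leave : Reaches I (.running (q + 8) s) (.running (q + 10) s) :=
    reaches_jump s (hI 7 (by norm_num))
  have chain : Reaches I (.running (q + 9) s) (.running (q + 18) s) :=
    reaches_jump s (hI 8 (by norm_num))
  have clause := reaches_CHECKc (I := I) (q := q + 2) (i := (φ m).2.2.2)
    (fun r hr => by
      have := hI (2 + r) (by omega)
      interval_cases r <;> exact this) h₁ h₂ h₃
  cases v with
  | false => exact ⟨fun _ => (reaches_polTest_eq h0 hv rfl).trans unselected, by simp, chain⟩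
  | true =>
    have enter := reaches_polTest_ne h0 hv (by simp)
    exact ⟨fun h => enter.trans ((clause.1 (h rfl)).trans leave),
      fun h => enter.trans (clause.2 fun hs => h fun _ => hs), chain⟩

/-- Behaviour of the last guarded check. -/
theorem reaches_guarded_last {I : List Instr} {K q : ℕ} {φ : ℕ → ℕ × ℕ × ℕ × ℕ} {s : St}
    {a : ℕ → Bool} {v : Bool}
    (hI : ∀ r < (guarded K φ K).length, I[q + r]? = (guarded K φ K)[r]?)
    (hv : s (.inp K) = some v)
    (h₁ : s (.aux (φ K).1) = some (a (φ K).1))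
    (h₂ : s (.aux (φ K).2.1) = some (a (φ K).2.1))
    (h₃ : s (.aux (φ K).2.2.1) = some (a (φ K).2.2.1)) :
    ((v = true → SatClause a (φ K)) → Reaches I (.running (q + 1) s) (.terminated true s)) ∧
    (¬ (v = true → SatClause a (φ K)) →
      Reaches I (.running (q + 1) s) (.running (q + 9) s)) := by
  simp only [guarded, lt_irrefl, if_false] at hI
  have hlen : ([.neg (.inp K) .get, .fjmp 6] ++ CHECKc (φ K) ++
    [.termT] : List Instr).length = 8 := by simp [CHECKc]
  rw [hlen] at hI
  have h0 : I[q]? = some (polTest false (.inp K)) := hI 0 (by norm_num)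
  have unselected : Reaches I (.running (q + 2) s) (.running (q + 8) s) :=
    reaches_jump s (hI 1 (by norm_num))
  have accept : Reaches I (.running (q + 8) s) (.terminated true s) :=
    reaches_termT s (hI 7 (by norm_num))
  have clause := reaches_CHECKc (I := I) (q := q + 2) (i := (φ K).2.2.2)
    (fun r hr => by
      have := hI (2 + r) (by omega)
      interval_cases r <;> exact this) h₁ h₂ h₃
  cases v with
  | false =>
    exact ⟨fun _ => (reaches_polTest_eq h0 hv rfl).trans (unselected.trans accept), by simp⟩
  | true =>
    have enter := reaches_polTest_ne h0 hv (by simp)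
    exact ⟨fun h => enter.trans ((clause.1 (h rfl)).trans accept),
      fun h => enter.trans (clause.2 fun hs => h fun _ => hs)⟩

/-- Behaviour of `CHECK` (followed by any nonempty `J`), where `in:m` holds the clause
selector `b_m` for `1 ≤ m ≤ 8k³` and `aux:i` holds the assignment value `a_i` for
`1 ≤ i ≤ k`: if the assignment `a` satisfies every clause `γ_{φ(m)}` with `b_m = t`,
execution terminates with reply `t` with all registers unchanged; otherwise execution
reaches position `72k³` (the first instruction of `J`) with all registers unchanged. -/
theorem statement7 (k : ℕ) (hk : 1 ≤ k) (φ : ℕ → ℕ × ℕ × ℕ × ℕ)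
    (hφ : Set.BijOn φ (Set.Icc 1 (8 * k ^ 3))
      (Set.Icc 1 k ×ˢ Set.Icc 1 k ×ˢ Set.Icc 1 k ×ˢ Set.Icc 1 8))
    (J : List Instr) (hJ : J ≠ []) (s : St) (b : ℕ → Bool) (a : ℕ → Bool)
    (hin : ∀ m : ℕ, 1 ≤ m → m ≤ 8 * k ^ 3 → s (.inp m) = some (b m))
    (haux : ∀ i : ℕ, 1 ≤ i → i ≤ k → s (.aux i) = some (a i)) :
    ((∀ m : ℕ, 1 ≤ m → m ≤ 8 * k ^ 3 → b m = true → SatClause a (φ m)) →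
      ∃ n : ℕ, run (CHECKseq k φ ++ J) s n = .terminated true s) ∧
    (¬ (∀ m : ℕ, 1 ≤ m → m ≤ 8 * k ^ 3 → b m = true → SatClause a (φ m)) →
      ∃ n : ℕ, run (CHECKseq k φ ++ J) s n = .running (72 * k ^ 3) s) := by
  set K := 8 * k ^ 3 with hK
  have hKpos : 0 < K := by positivity
  have hK9 : 72 * k ^ 3 = 9 * K := by omega
  set I := CHECKseq k φ ++ J
  have hget (j : ℕ) (hj : j < K) : ∀ r < (guarded K φ (j + 1)).length,
      I[9 * j + r]? = (guarded K φ (j + 1))[r]? :=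
    fun r hr => getElem?_flatMap_guarded φ J hj hr
  have hvars (m : ℕ) (h1 : 1 ≤ m) (h2 : m ≤ K) :
      s (.aux (φ m).1) = some (a (φ m).1) ∧ s (.aux (φ m).2.1) = some (a (φ m).2.1) ∧
        s (.aux (φ m).2.2.1) = some (a (φ m).2.2.1) := by
    obtain ⟨h, h', h'', -⟩ := hφ.mapsTo (Set.mem_Icc.2 ⟨h1, h2⟩)
    exact ⟨haux _ h.1 h.2, haux _ h'.1 h'.2, haux _ h''.1 h''.2⟩
  have block (j : ℕ) (hj : j + 1 < K) :=
    have hv := hvars (j + 1) (by omega) hj.le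
    reaches_guarded_of_lt hj (hget j (by omega)) (hin (j + 1) (by omega) hj.le)
      hv.1 hv.2.1 hv.2.2
  obtain ⟨N, hN⟩ : ∃ N, K = N + 1 := ⟨K - 1, by omega⟩
  have last := have hv := hvars K hKpos le_rfl
    reaches_guarded_last (q := 9 * N) (by simpa only [← hN] using hget N (by omega))
      (hin K hKpos le_rfl) hv.1 hv.2.1 hv.2.2
  have pass (j : ℕ) (hj : j < K)
      (h : ∀ m, 1 ≤ m → m ≤ j → b m = true → SatClause a (φ m)) :
      Reaches I (.running 1 s) (.running (9 * j + 1) s) := by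
    induction j with
    | zero => exact .refl ..
    | succ j ih =>
      exact (ih (by omega) fun m h1 h2 => h m h1 (by omega)).trans
        ((block j hj).1 (h _ (by omega) le_rfl))
  refine ⟨fun h => (pass N (by omega) fun m h1 h2 => h m h1 (by omega)).trans
    (last.1 (h K hKpos le_rfl)), fun h => ?_⟩
  have chain (j : ℕ) (hj : j < K)
      (h : ¬ ∀ m, 1 ≤ m → m ≤ j + 1 → b m = true → SatClause a (φ m)) :
      Reaches I (.running 1 s) (.running (9 * j + 9) s) := by
    induction j using Nat.strong_induction_on with | _ j ih =>
    have check : (¬ (b (j + 1) = true → SatClause a (φ (j + 1)))) →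
        Reaches I (.running (9 * j + 1) s) (.running (9 * j + 9) s) := by
      rcases (Nat.succ_le_of_lt hj).lt_or_eq with hlt | heq
      · exact (block j hlt).2.1
      · obtain rfl : j = N := by omega
        simpa only [hN] using last.2
    by_cases hpre : ∀ m, 1 ≤ m → m ≤ j → b m = true → SatClause a (φ m)
    · refine (pass j hj hpre).trans (check fun hc => h fun m h1 h2 => ?_)
      rcases Nat.le_succ_iff.1 h2 with h2 | rfl
      · exact hpre m h1 h2
      · exact hc
    · cases j with
      | zero => exact (hpre fun m h1 h2 => by omega).elim
      | succ j => exact (ih j (by omega) (by omega) hpre).trans (block j hj).2.2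
  rw [hK9, hN]
  exact chain N (by omega) (by rwa [← hN])
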